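/- Fix a user κ ∈ {1,…,N} with N ≥ 1. Under the product measure on Ω = (Fin N → Fin m) with i.i.d. coordinates of law ρ, the probability of the Half-Duplex Transmitter (HDTX) event {r ∈ Ω : r(κ) ∉ {1,…,N} and ∃ τ ≠ κ, r(τ) = κ} equals (1 − P_hit)(1 − (1 − ρ_κ)^{N−1}), where P_hit = Σ_{ℓ=1}^N ρ_ℓ. Consequently, the probability that a uniformly chosen user operates in HDTX mode equals (1/N) Σ_{κ=1}^N (1 − P_hit)(1 − (1 − ρ_κ)^{N−1}). -/

import Mathlib

open Finset

open scoped Classical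

/-- Zipf popularity: content `κ` (0-indexed, representing content `κ+1`) has
popularity `(κ+1)^{-γ} / ∑_{η=1}^m η^{-γ}`. -/
noncomputable def zipf (m : ℕ) (γ : ℝ) (κ : Fin m) : ℝ :=
  (((κ : ℕ) : ℝ) + 1) ^ (-γ) / ∑ η : Fin m, (((η : ℕ) : ℝ) + 1) ^ (-γ)

/-- Probability of the event `E` on `Ω = (Fin N → Fin m)` under the product measure in
which each coordinate is i.i.d. with probability mass function `ρ`. -/
noncomputable def prob {N m : ℕ} (ρ : Fin m → ℝ) (E : (Fin N → Fin m) → Prop) : ℝ :=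
  ∑ r : Fin N → Fin m, if E r then ∏ τ : Fin N, ρ (r τ) else 0

theorem sum_zipf {m : ℕ} (hm : 0 < m) (γ : ℝ) : ∑ a : Fin m, zipf m γ a = 1 := by
  have : Nonempty (Fin m) := ⟨⟨0, hm⟩⟩
  simp only [zipf]
  rw [← Finset.sum_div]
  exact div_self (Finset.sum_pos (fun a _ => by positivity) Finset.univ_nonempty).ne'

/-- Probability of a product event. -/
theorem prob_forall {N m : ℕ} (ρ : Fin m → ℝ) (P : Fin N → Fin m → Prop) :
    prob ρ (fun r => ∀ τ, P τ (r τ)) = ∏ τ, ∑ a, if P τ a then ρ a else 0 := by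
  rw [Finset.prod_univ_sum, Fintype.piFinset_univ, prob]
  refine Finset.sum_congr rfl fun r _ => ?_
  rw [Finset.prod_ite_zero]
  simp

theorem prob_and_eq_sub {N m : ℕ} (ρ : Fin m → ℝ) (E F : (Fin N → Fin m) → Prop) :
    prob ρ (fun r => E r ∧ F r) = prob ρ E - prob ρ (fun r => E r ∧ ¬ F r) := by
  simp only [prob]
  rw [← Finset.sum_sub_distrib]
  refine Finset.sum_congr rfl fun r _ => ?_
  by_cases hE : E r <;> by_cases hF : F r <;> simp [hE, hF]

/-- If user `κ` requests a content satisfying `A` and every other user one satisfying `B`, the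
probabilities multiply. -/
theorem prob_and_forall_ne {N m : ℕ} (ρ : Fin m → ℝ) (A B : Fin m → Prop)
    [DecidablePred A] [DecidablePred B] (κ : Fin N) :
    prob ρ (fun r => A (r κ) ∧ ∀ τ, τ ≠ κ → B (r τ)) =
      (∑ a, if A a then ρ a else 0) * (∑ a, if B a then ρ a else 0) ^ (N - 1) := by
  have h : (fun r : Fin N → Fin m => A (r κ) ∧ ∀ τ, τ ≠ κ → B (r τ)) =
      fun r => ∀ τ, (if τ = κ then A else B) (r τ) := by
    funext r
    refine propext ⟨fun h τ => ?_, fun h => ⟨by simpa using h κ, fun τ hτ => ?_⟩⟩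
    · by_cases hτ : τ = κ
      · simpa [hτ] using h.1
      · simpa [hτ] using h.2 τ hτ
    · simpa [hτ] using h τ
  rw [h, prob_forall, ← Finset.mul_prod_erase _ _ (Finset.mem_univ κ)]
  congr 1
  · simp
  · rw [Finset.prod_congr rfl (g := fun _ => ∑ a, if B a then ρ a else 0)]
    · simp
    · intro τ hτ
      simp [Finset.ne_of_mem_erase hτ]

theorem prob_and_exists_ne {N m : ℕ} {ρ : Fin m → ℝ} (hρ : ∑ a, ρ a = 1) (A : Fin m → Prop)
    [DecidablePred A]
    (c : Fin m) (κ : Fin N) :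
    prob ρ (fun r => A (r κ) ∧ ∃ τ, τ ≠ κ ∧ r τ = c) =
      (∑ a, if A a then ρ a else 0) * (1 - (1 - ρ c) ^ (N - 1)) := by
  have hA := prob_and_forall_ne ρ A (fun _ => True) κ
  have hB := prob_and_forall_ne ρ A (fun a => a ≠ c) κ
  have hc : (∑ a, if a ≠ c then ρ a else 0) = 1 - ρ c := by
    rw [← hρ, ← Finset.sum_filter, Finset.filter_ne', ← Finset.add_sum_erase _ _ (mem_univ c)]
    ring
  simp only [if_true, hρ, one_pow, mul_one, implies_true, and_true] at hA
  rw [hc] at hB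
  rw [prob_and_eq_sub, hA]
  simp only [not_exists, not_and]
  rw [hB]
  ring

theorem sum_ite_not_lt {N m : ℕ} (hNm : N ≤ m) {ρ : Fin m → ℝ} (hρ : ∑ a, ρ a = 1) :
    (∑ a : Fin m, if ¬ (a : ℕ) < N then ρ a else 0) =
      1 - ∑ ℓ : Fin N, ρ (Fin.castLE hNm ℓ) := by
  obtain ⟨k, rfl⟩ := Nat.exists_eq_add_of_le hNm
  rw [← hρ, Fin.sum_univ_add, Fin.sum_univ_add]
  simp [Fin.castAdd]

/-- HDTX mode: user `κ`'s requested content is not cached by any user (a cache miss: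
its index exceeds `N`), but at least one other user requests content `κ`. Its
probability is `(1 - P_hit)(1 - (1-ρ_κ)^(N-1))`, and the probability that a uniformly
chosen user operates in HDTX mode is the average. -/
theorem prob_HDTX (m N : ℕ) (γr : ℝ) (hγr : 0 < γr)
    (hN : 1 ≤ N) (hNm : N ≤ m) (ρ : Fin m → ℝ) (hρ : ρ = zipf m γr) (κ : Fin N) :
    prob ρ (fun r => ¬ (((r κ : Fin m) : ℕ) < N) ∧
        ∃ τ : Fin N, τ ≠ κ ∧ r τ = Fin.castLE hNm κ)
      = (1 - ∑ ℓ : Fin N, ρ (Fin.castLE hNm ℓ)) *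
          (1 - (1 - ρ (Fin.castLE hNm κ)) ^ (N - 1))
    ∧ (1 / (N : ℝ)) * ∑ κ' : Fin N,
        prob ρ (fun r => ¬ (((r κ' : Fin m) : ℕ) < N) ∧
          ∃ τ : Fin N, τ ≠ κ' ∧ r τ = Fin.castLE hNm κ')
      = (1 / (N : ℝ)) * ∑ κ' : Fin N,
          (1 - ∑ ℓ : Fin N, ρ (Fin.castLE hNm ℓ)) *
            (1 - (1 - ρ (Fin.castLE hNm κ')) ^ (N - 1)) := by
  have hsum : ∑ a, ρ a = 1 := hρ ▸ sum_zipf (hN.trans hNm) γr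
  have key (κ : Fin N) := (prob_and_exists_ne hsum (fun a => ¬ (a : ℕ) < N)
    (Fin.castLE hNm κ) κ).trans (congrArg (· * _) (sum_ite_not_lt hNm hsum))
  exact ⟨key κ, congrArg _ (Finset.sum_congr rfl fun κ' _ => key κ')⟩
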